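/- Let G be a finite connected distance-hereditary graph, let x,y be a mutually distant pair of vertices, let u be any vertex and let v ∈ F(u). Set α = d(u,x) and β = d(u,y). Then max{α,β} ≤ e(u) ≤ max{ max{α,β}, min{α,β}+2 } ≤ max{α,β}+2. Moreover, if e(u) = max{α,β}+2, then α = β = e(u)−2 and d(v,x) = d(v,y) = d(x,y). -/

import Mathlib

/-- A graph is distance-hereditary if every connected induced subgraph is isometric
(equivalently, every induced path is a shortest path). -/
def DistHereditary {V : Type*} (G : SimpleGraph V) : Prop :=
  ∀ s : Set V, (G.induce s).Connected →
    ∀ u v : s, (G.induce s).dist u v = G.dist (u : V) (v : V)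

/-- Eccentricity of a vertex: `e(v) = max_{u} d(v,u)`. -/
noncomputable def ecc {V : Type*} [Fintype V] (G : SimpleGraph V) (v : V) : ℕ :=
  Finset.univ.sup (fun u => G.dist v u)

/-- Radius: minimum eccentricity. -/
noncomputable def rad {V : Type*} [Fintype V] (G : SimpleGraph V) : ℕ :=
  sInf (Set.range (ecc G))

/-- Diameter: maximum eccentricity. -/
noncomputable def diam {V : Type*} [Fintype V] (G : SimpleGraph V) : ℕ :=
  Finset.univ.sup (fun v => ecc G v)

/-- The center: vertices of minimum eccentricity. -/
def center {V : Type*} [Fintype V] (G : SimpleGraph V) : Set V :=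
  {v | ecc G v = rad G}

/-- Distance from a vertex to a set of vertices: `d(v,S) = min_{s ∈ S} d(v,s)`. -/
noncomputable def distToSet {V : Type*} (G : SimpleGraph V) (v : V) (S : Set V) : ℕ :=
  sInf ((G.dist v) '' S)

/-- The interval `I(x,y)`: vertices on shortest `(x,y)`-paths. -/
def interval {V : Type*} (G : SimpleGraph V) (x y : V) : Set V :=
  {v | G.dist x v + G.dist v y = G.dist x y}

/-- The intervalSlice `S_k(x,y) = {v ∈ I(x,y) : d(x,v) = k}`. -/
def intervalSlice {V : Type*} (G : SimpleGraph V) (x y : V) (k : ℕ) : Set V :=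
  {v | v ∈ interval G x y ∧ G.dist x v = k}

/-- The set `S` induces a cograph in `G`: no induced path on four vertices within `S`. -/
def IsCographOn {V : Type*} (G : SimpleGraph V) (S : Set V) : Prop :=
  ¬ ∃ a b c d : V, a ∈ S ∧ b ∈ S ∧ c ∈ S ∧ d ∈ S ∧
    a ≠ c ∧ a ≠ d ∧ b ≠ d ∧
    G.Adj a b ∧ G.Adj b c ∧ G.Adj c d ∧ ¬ G.Adj a c ∧ ¬ G.Adj a d ∧ ¬ G.Adj b d

namespace SimpleGraph

variable {V : Type*} {G : SimpleGraph V}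

/-- The vertices `x` and `y` are joined by a walk that stays at distance at least `k` from `u`. -/
def JoinedAbove (G : SimpleGraph V) (u : V) (k : ℕ) (x y : V) : Prop :=
  ∃ p : G.Walk x y, ∀ z ∈ p.support, k ≤ G.dist u z

namespace JoinedAbove

variable {u x y z : V} {k : ℕ}

theorem refl (h : k ≤ G.dist u x) : G.JoinedAbove u k x x :=
  ⟨.nil, by simpa using h⟩

theorem symm (h : G.JoinedAbove u k x y) : G.JoinedAbove u k y x := by
  obtain ⟨p, hp⟩ := h
  exact ⟨p.reverse, by simpa using hp⟩

theorem trans (h : G.JoinedAbove u k x y) (h' : G.JoinedAbove u k y z) :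
    G.JoinedAbove u k x z := by
  obtain ⟨p, hp⟩ := h
  obtain ⟨q, hq⟩ := h'
  refine ⟨p.append q, fun t ht => ?_⟩
  rcases Walk.mem_support_append_iff .. |>.1 ht with ht | ht
  exacts [hp t ht, hq t ht]

theorem cons (hx : k ≤ G.dist u x) (hxy : G.Adj x y) (h : G.JoinedAbove u k y z) :
    G.JoinedAbove u k x z := by
  obtain ⟨p, hp⟩ := h
  refine ⟨.cons hxy p, fun t ht => ?_⟩
  rcases List.mem_cons.1 (Walk.support_cons hxy p ▸ ht) with rfl | ht
  exacts [hx, hp t ht]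

theorem le_left (h : G.JoinedAbove u k x y) : k ≤ G.dist u x := by
  obtain ⟨p, hp⟩ := h
  exact hp x p.start_mem_support

theorem le_right (h : G.JoinedAbove u k x y) : k ≤ G.dist u y :=
  h.symm.le_left

theorem of_dist_add_le (hconn : G.Connected) (h : G.dist x z + k ≤ G.dist u x) :
    G.JoinedAbove u k x z := by
  classical
  obtain ⟨p, hp⟩ := hconn.exists_walk_length_eq_dist x z
  refine ⟨p, fun t ht => ?_⟩
  have h₁ := (dist_le (p.takeUntil t ht)).trans (p.length_takeUntil_le_length ht)
  have h₂ : G.dist u x ≤ G.dist u t + G.dist t x := hconn.dist_triangle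
  rw [G.dist_comm (u := t)] at h₂
  omega

end JoinedAbove

theorem Adj.dist_le_add_one {u x y : V} (hconn : G.Connected) (h : G.Adj x y) :
    G.dist u x ≤ G.dist u y + 1 := by
  have h₁ : G.dist u x ≤ G.dist u y + G.dist y x := hconn.dist_triangle
  rwa [dist_eq_one_iff_adj.2 h.symm] at h₁

theorem Connected.exists_adj_dist_add_one_eq (hconn : G.Connected) {x y : V} (hne : x ≠ y) :
    ∃ w, G.Adj x w ∧ G.dist w y + 1 = G.dist x y := by
  obtain ⟨p, hp⟩ := hconn.exists_walk_length_eq_dist x y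
  cases p with
  | nil => exact absurd rfl hne
  | @cons _ w _ hw q =>
    refine ⟨w, hw, ?_⟩
    have h₁ := dist_le q
    have h₂ := hw.dist_le_add_one (u := y) hconn
    rw [G.dist_comm (u := y), G.dist_comm (u := y)] at h₂
    rw [Walk.length_cons] at hp
    omega

/-- Some geodesic from `x` to `u` meets a given sphere around `u` of radius at most `d(u,x)`. -/
theorem Connected.exists_dist_eq_dist_add_eq (hconn : G.Connected) {u x : V} {k : ℕ}
    (hk : k ≤ G.dist u x) : ∃ z, G.dist u z = k ∧ G.dist x z + k = G.dist u x := by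
  induction n : G.dist u x - k generalizing x with
  | zero => exact ⟨x, by omega, by simp; omega⟩
  | succ n ih =>
    have hne : x ≠ u := by rintro rfl; simp at n
    obtain ⟨w, hxw, hw⟩ := hconn.exists_adj_dist_add_one_eq hne
    rw [G.dist_comm (u := w), G.dist_comm (u := x)] at hw
    obtain ⟨z, hz, hwz⟩ := ih (x := w) (by omega) (by omega)
    refine ⟨z, hz, ?_⟩
    have h₁ := hxw.dist_le_add_one (u := z) hconn
    have h₂ : G.dist u x ≤ G.dist u z + G.dist z x := hconn.dist_triangle
    rw [G.dist_comm (u := z), G.dist_comm (u := z)] at h₁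
    rw [G.dist_comm (u := z)] at h₂
    omega

theorem Connected.exists_walk_dist_le (hconn : G.Connected) (u x : V) :
    ∃ p : G.Walk x u, ∀ z ∈ p.support, z = x ∨ G.dist u z < G.dist u x := by
  induction n : G.dist u x generalizing x with
  | zero =>
    obtain rfl := hconn.dist_eq_zero_iff.1 n
    exact ⟨.nil, by simp⟩
  | succ n ih =>
    have hne : x ≠ u := by rintro rfl; simp at n
    obtain ⟨w, hxw, hw⟩ := hconn.exists_adj_dist_add_one_eq hne
    rw [G.dist_comm (u := w), G.dist_comm (u := x)] at hw
    obtain ⟨p, hp⟩ := ih w (by omega)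
    refine ⟨.cons hxw p, fun z hz => ?_⟩
    rcases List.mem_cons.1 (Walk.support_cons hxw p ▸ hz) with rfl | hz
    · exact .inl rfl
    · rcases hp z hz with rfl | h <;> right <;> omega

/-- A pair of vertices that no walk above level `k` joins has a geodesic whose first vertex below
level `k` is either its start or adjacent to a vertex joined to the start. -/
theorem Connected.exists_first_below (hconn : G.Connected) {u x v : V} {k : ℕ}
    (h : ¬ G.JoinedAbove u k x v) :
    ∃ w, G.dist u w < k ∧ G.dist x w + G.dist w v = G.dist x v ∧
      (w = x ∨ ∃ w', G.JoinedAbove u k x w' ∧ G.Adj w' w) := by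
  induction n : G.dist x v generalizing x with
  | zero =>
    obtain rfl := hconn.dist_eq_zero_iff.1 n
    exact ⟨x, not_le.1 fun hk => h (.refl hk), by simp, .inl rfl⟩
  | succ n ih =>
    rcases lt_or_ge (G.dist u x) k with hk | hk
    · exact ⟨x, hk, by simpa using n, .inl rfl⟩
    have hne : x ≠ v := by rintro rfl; simp at n
    obtain ⟨x', hxx', hx'⟩ := hconn.exists_adj_dist_add_one_eq hne
    obtain ⟨w, hw, hsum, hor⟩ := ih (fun h' => h (.cons hk hxx' h')) (by omega)
    refine ⟨w, hw, ?_, .inr ?_⟩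
    · have h₁ := hxx'.dist_le_add_one (u := w) hconn
      have h₂ : G.dist x v ≤ G.dist x w + G.dist w v := hconn.dist_triangle
      rw [G.dist_comm (u := w), G.dist_comm (u := w)] at h₁
      omega
    · rcases hor with rfl | ⟨w', hw', hadj⟩
      · exact ⟨x, .refl hk, hxx'⟩
      · exact ⟨w', .cons hk hxx' hw', hadj⟩

end SimpleGraph

namespace DistHereditary

open SimpleGraph

variable {V : Type*} {G : SimpleGraph V} {u x y v : V} {k m : ℕ}

/-- The support of every walk contains a neighbour of its start that is closer to its end. -/
theorem exists_mem_support_adj (hdh : DistHereditary G)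
    (p : G.Walk x y) (hne : x ≠ y) :
    ∃ w ∈ p.support, G.Adj x w ∧ G.dist w y + 1 = G.dist x y := by
  have hc : (G.induce {z | z ∈ p.support}).Connected := p.connected_induce_support
  have hd := hdh _ hc
  obtain ⟨w, hw, hsum⟩ := hc.exists_adj_dist_add_one_eq
    (x := ⟨x, p.start_mem_support⟩) (y := ⟨y, p.end_mem_support⟩) (by simpa using hne)
  rw [hd, hd] at hsum
  exact ⟨w, w.2, hw, hsum⟩

/-- Vertices of the sphere of radius `k` around `u` that are joined above level `k` have the same
neighbours at distance `k - 1` from `u`. -/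
theorem adj_of_joinedAbove (hconn : G.Connected) (hdh : DistHereditary G) {t : V}
    (hx : G.dist u x = k) (h : G.JoinedAbove u k x y)
    (hty : G.Adj y t) (ht : G.dist u t + 1 = k) : G.Adj x t := by
  obtain ⟨p, hp⟩ := h
  obtain ⟨q, hq⟩ := hconn.exists_walk_dist_le u t
  have hne : x ≠ u := by rintro rfl; simp at hx; omega
  obtain ⟨w, hw, hxw, hd⟩ := hdh.exists_mem_support_adj (p.append (.cons hty q)) hne
  rw [G.dist_comm (u := w), G.dist_comm (u := x)] at hd
  rw [Walk.mem_support_append_iff, Walk.support_cons, List.mem_cons] at hw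
  rcases hw with hw | rfl | hw
  · have := hp w hw; omega
  · have := hp w p.end_mem_support; omega
  · rcases hq w hw with rfl | h
    · exact hxw
    · omega

/-- A vertex at distance `m` from `u` that is adjacent to some vertex joined to `x` above level
`m + 1` lies on a geodesic from `x` to `u`. -/
theorem dist_add_eq_of_joinedAbove (hconn : G.Connected) (hdh : DistHereditary G) {w w' : V}
    (h : G.JoinedAbove u (m + 1) x w') (hadj : G.Adj w' w) (hw : G.dist u w = m) :
    G.dist x w + m = G.dist u x := by
  obtain ⟨z, hz, hxz⟩ := hconn.exists_dist_eq_dist_add_eq h.le_left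
  have hzw := hdh.adj_of_joinedAbove hconn hz
    ((JoinedAbove.of_dist_add_le hconn hxz.le).symm.trans h) hadj (by omega)
  have h₁ := hzw.symm.dist_le_add_one (u := x) hconn
  have h₂ : G.dist u x ≤ G.dist u w + G.dist w x := hconn.dist_triangle
  rw [G.dist_comm (u := w)] at h₂
  omega

/-- Vertices joined above level `m + 1` have the same projections to the sphere of radius `m`. -/
theorem dist_add_eq_congr (hconn : G.Connected) (hdh : DistHereditary G) {w : V}
    (h : G.JoinedAbove u (m + 1) x y) (hw : G.dist u w = m)
    (hxw : G.dist x w + m = G.dist u x) : G.dist y w + m = G.dist u y := by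
  have hm := h.le_left
  have hne : w ≠ x := by rintro rfl; omega
  obtain ⟨w', hadj, hw'⟩ := hconn.exists_adj_dist_add_one_eq hne
  rw [G.dist_comm (u := w'), G.dist_comm (u := w)] at hw'
  exact hdh.dist_add_eq_of_joinedAbove hconn
    (h.symm.trans (.of_dist_add_le hconn (by omega))) hadj.symm hw

theorem exists_projection (hconn : G.Connected) (hdh : DistHereditary G)
    (hx : m ≤ G.dist u x) (h : ¬ G.JoinedAbove u (m + 1) x v) :
    ∃ w, G.dist u w = m ∧ G.dist x w + m = G.dist u x ∧
      G.dist x w + G.dist w v = G.dist x v := by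
  obtain ⟨w, hw, hsum, rfl | ⟨w', hw', hadj⟩⟩ := hconn.exists_first_below h
  · exact ⟨w, by omega, by simp; omega, hsum⟩
  · have h₁ := hadj.dist_le_add_one (u := u) hconn
    have h₂ := hw'.le_right
    have hm : G.dist u w = m := by omega
    exact ⟨w, hm, hdh.dist_add_eq_of_joinedAbove hconn hw' hadj hm, hsum⟩

/-- A pair not joined above level `m + 1` has a geodesic through projections of both ends to the
sphere of radius `m` around `u`. -/
theorem exists_projection_pair (hconn : G.Connected) (hdh : DistHereditary G)
    (hx : m ≤ G.dist u x) (hv : m ≤ G.dist u v) (h : ¬ G.JoinedAbove u (m + 1) x v) :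
    ∃ w r, G.dist u w = m ∧ G.dist u r = m ∧ G.dist x w + m = G.dist u x ∧
      G.dist v r + m = G.dist u v ∧
      G.dist x v + 2 * m = G.dist u x + G.dist u v + G.dist w r := by
  obtain ⟨w, hw, hxw, hsum⟩ := hdh.exists_projection hconn hx h
  have hvw : ¬ G.JoinedAbove u (m + 1) v w := fun h' => by have := h'.le_right; omega
  obtain ⟨r, hr, hvr, hsum'⟩ := hdh.exists_projection hconn hv hvw
  rw [G.dist_comm (u := v) (v := w), G.dist_comm (u := r)] at hsum'
  exact ⟨w, r, hw, hr, hxw, hvr, by omega⟩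

theorem dist_add_le_of_joinedAbove (hconn : G.Connected) (hdh : DistHereditary G)
    (hxy : G.JoinedAbove u (m + 1) x y) (hxv : ¬ G.JoinedAbove u (m + 1) x v) :
    G.dist y v + G.dist u x ≤ G.dist x v + G.dist u y := by
  obtain ⟨w, hw, hxw, hsum⟩ :=
    hdh.exists_projection hconn ((Nat.le_succ m).trans hxy.le_left) hxv
  have h₁ := hdh.dist_add_eq_congr hconn hxy hw hxw
  have h₂ : G.dist y v ≤ G.dist y w + G.dist w v := hconn.dist_triangle
  omega

theorem dist_le_of_joinedAbove (hconn : G.Connected) (hdh : DistHereditary G)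
    (h : G.JoinedAbove u k x y) : G.dist x y + 2 * k ≤ G.dist u x + G.dist u y + 2 := by
  rcases k with _ | m
  · have h₁ : G.dist x y ≤ G.dist x u + G.dist u y := hconn.dist_triangle
    rw [G.dist_comm (u := x) (v := u)] at h₁
    omega
  · obtain ⟨w, hw, hxw⟩ := hconn.exists_dist_eq_dist_add_eq ((Nat.le_succ m).trans h.le_left)
    have h₁ := hdh.dist_add_eq_congr hconn h hw hxw
    have h₂ : G.dist x y ≤ G.dist x w + G.dist w y := hconn.dist_triangle
    rw [G.dist_comm (u := w)] at h₂
    omega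

/-- Three vertices joined above level `m`, no two of them above level `m + 1`, do not have pairwise
distances that exceed the sums of their heights above level `m` by `0`, `1` and `2`. -/
theorem not_excess_zero_one_two (hconn : G.Connected) (hdh : DistHereditary G)
    (hm : G.JoinedAbove u m x v) (hxy : ¬ G.JoinedAbove u (m + 1) x y)
    (hyv : ¬ G.JoinedAbove u (m + 1) y v) (hy : m ≤ G.dist u y)
    (h₀ : G.dist x y + 2 * m = G.dist u x + G.dist u y)
    (h₁ : G.dist y v + 2 * m = G.dist u y + G.dist u v + 1) :
    G.dist x v + 2 * m ≠ G.dist u x + G.dist u v + 2 := by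
  intro h₂
  have hx := hm.le_left
  have hv := hm.le_right
  obtain ⟨p, p', hp, -, hxp, hyp, hd⟩ := hdh.exists_projection_pair hconn hx hy hxy
  obtain rfl : p = p' := hconn.dist_eq_zero_iff.1 (by omega)
  obtain ⟨q, r, hq, hr, hyq, hvr, hd'⟩ := hdh.exists_projection_pair hconn hy hv hyv
  have hqr : G.Adj q r := dist_eq_one_iff_adj.1 (by omega)
  have hpr : 2 ≤ G.dist p r := by
    have e₁ : G.dist x v ≤ G.dist x p + G.dist p v := hconn.dist_triangle
    have e₂ : G.dist p v ≤ G.dist p r + G.dist r v := hconn.dist_triangle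
    rw [G.dist_comm (u := r)] at e₂
    omega
  have hpr' : ¬ G.Adj p r := fun h => by have := dist_eq_one_iff_adj.2 h; omega
  have hym : m + 1 ≤ G.dist u y := by
    by_contra hlt
    obtain rfl : y = p := hconn.dist_eq_zero_iff.1 (by omega)
    obtain rfl : y = q := hconn.dist_eq_zero_iff.1 (by omega)
    exact hpr' hqr
  obtain ⟨z, hz, hyz⟩ := hconn.exists_dist_eq_dist_add_eq hym
  have hjoin := JoinedAbove.of_dist_add_le hconn hyz.le
  have hzp : G.Adj z p := dist_eq_one_iff_adj.1 <| by
    have := hdh.dist_add_eq_congr hconn hjoin hp hyp; omega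
  have hzq : G.Adj z q := dist_eq_one_iff_adj.1 <| by
    have := hdh.dist_add_eq_congr hconn hjoin hq hyq; omega
  have hzr : 2 ≤ G.dist z r := by
    have e₁ : G.dist y v ≤ G.dist y z + G.dist z v := hconn.dist_triangle
    have e₂ : G.dist z v ≤ G.dist z r + G.dist r v := hconn.dist_triangle
    rw [G.dist_comm (u := r)] at e₂
    omega
  have hpu : p ≠ u := by
    rintro rfl
    obtain rfl : p = r := hconn.dist_eq_zero_iff.1 (by simp at hp; omega)
    simp at hpr
  obtain ⟨t, hpt, ht⟩ := hconn.exists_adj_dist_add_one_eq hpu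
  rw [G.dist_comm (u := t), G.dist_comm (u := p)] at ht
  have hrp : G.JoinedAbove u m r p :=
    (JoinedAbove.of_dist_add_le hconn hvr.le).symm.trans
      (hm.symm.trans (.of_dist_add_le hconn hxp.le))
  have hrt := hdh.adj_of_joinedAbove hconn hr hrp hpt (by omega)
  have hzr' : G.dist z r ≤ 2 := by
    have := hzq.dist_le_add_one (u := r) hconn
    rw [G.dist_comm (u := r), G.dist_comm (u := r), dist_eq_one_iff_adj.2 hqr] at this
    exact this
  have hne : z ≠ r := by rintro rfl; simp at hzr
  obtain ⟨w, hw, hzw, hwr⟩ := hdh.exists_mem_support_adj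
    (.cons hzp (.cons hpt (.cons hrt.symm .nil))) hne
  simp only [Walk.support_cons, Walk.support_nil, List.mem_cons, List.not_mem_nil,
    or_false] at hw
  rcases hw with rfl | rfl | rfl | rfl
  · exact hzw.ne rfl
  · omega
  · have := hzw.dist_le_add_one (u := u) hconn; omega
  · simp at hwr; omega

theorem four_point_of_joinedAbove (hconn : G.Connected) (hdh : DistHereditary G)
    (hxy : G.JoinedAbove u (m + 1) x y) (hxv : ¬ G.JoinedAbove u (m + 1) x v)
    (hv : m ≤ G.dist u v) :
    G.dist u x + G.dist y v = G.dist u y + G.dist x v ∧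
      G.dist u v + G.dist x y ≤ G.dist u x + G.dist y v := by
  have h₁ := hdh.dist_add_le_of_joinedAbove hconn hxy hxv
  have h₂ := hdh.dist_add_le_of_joinedAbove hconn hxy.symm fun h => hxv (hxy.trans h)
  have h₃ := hdh.dist_le_of_joinedAbove hconn hxy
  obtain ⟨w, r, -, -, -, -, h₄⟩ :=
    hdh.exists_projection_pair hconn ((Nat.le_succ m).trans hxy.le_left) hv hxv
  omega

theorem exists_excess (hconn : G.Connected) (hdh : DistHereditary G)
    (h : G.JoinedAbove u m x y) (h' : ¬ G.JoinedAbove u (m + 1) x y) :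
    ∃ i ≤ 2, G.dist x y + 2 * m = G.dist u x + G.dist u y + i := by
  obtain ⟨w, r, -, -, -, -, hd⟩ := hdh.exists_projection_pair hconn h.le_left h.le_right h'
  have hle := hdh.dist_le_of_joinedAbove hconn h
  exact ⟨G.dist w r, by omega, hd⟩

/-- The four-point condition: two of the three distance sums of four vertices agree, and the third
one exceeds them by at most two. -/
theorem four_point (hconn : G.Connected) (hdh : DistHereditary G) (u x y v : V) :
    (G.dist u x + G.dist y v = G.dist u y + G.dist x v ∧
      G.dist u v + G.dist x y ≤ G.dist u x + G.dist y v + 2) ∨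
    (G.dist u x + G.dist y v = G.dist u v + G.dist x y ∧
      G.dist u y + G.dist x v ≤ G.dist u x + G.dist y v + 2) ∨
    (G.dist u y + G.dist x v = G.dist u v + G.dist x y ∧
      G.dist u x + G.dist y v ≤ G.dist u y + G.dist x v + 2) := by
  classical
  have hex : ∃ k, ¬ (G.JoinedAbove u k x y ∧ G.JoinedAbove u k x v) :=
    ⟨G.dist u x + 1, fun h => by have := h.1.le_left; omega⟩
  obtain ⟨m, hm⟩ : ∃ m, Nat.find hex = m + 1 := by
    refine Nat.exists_eq_succ_of_ne_zero fun h => Nat.find_spec hex ?_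
    rw [h]
    exact ⟨(hconn x y).elim fun p => ⟨p, by simp⟩, (hconn x v).elim fun p => ⟨p, by simp⟩⟩
  have hnot := hm ▸ Nat.find_spec hex
  obtain ⟨jxy, jxv⟩ := not_not.1 (Nat.find_min hex (m := m) (by omega))
  have jyv := jxy.symm.trans jxv
  have hx := jxy.le_left
  have hy := jxy.le_right
  have hv := jxv.le_right
  have cyx := G.dist_comm (u := y) (v := x)
  have cvx := G.dist_comm (u := v) (v := x)
  have cvy := G.dist_comm (u := v) (v := y)
  by_cases nxy : G.JoinedAbove u (m + 1) x y
  · have := hdh.four_point_of_joinedAbove hconn nxy (fun h => hnot ⟨nxy, h⟩) hv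
    omega
  by_cases nxv : G.JoinedAbove u (m + 1) x v
  · have := hdh.four_point_of_joinedAbove hconn nxv nxy hy
    omega
  by_cases nyv : G.JoinedAbove u (m + 1) y v
  · have := hdh.four_point_of_joinedAbove hconn nyv (fun h => nxy h.symm) hx
    omega
  have nyx := fun h : G.JoinedAbove u (m + 1) y x => nxy h.symm
  have nvx := fun h : G.JoinedAbove u (m + 1) v x => nxv h.symm
  have nvy := fun h : G.JoinedAbove u (m + 1) v y => nyv h.symm
  obtain ⟨i, hi, hxy⟩ := hdh.exists_excess hconn jxy nxy
  obtain ⟨j, hj, hxv⟩ := hdh.exists_excess hconn jxv nxv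
  obtain ⟨l, hl, hyv⟩ := hdh.exists_excess hconn jyv nyv
  have e₁ := hdh.not_excess_zero_one_two hconn jxv nxy nyv hy
  have e₂ := hdh.not_excess_zero_one_two hconn jxv.symm nvy nyx hy
  have e₃ := hdh.not_excess_zero_one_two hconn jxy nxv nvy hv
  have e₄ := hdh.not_excess_zero_one_two hconn jxy.symm nyv nvx hv
  have e₅ := hdh.not_excess_zero_one_two hconn jyv nyx nxv hx
  have e₆ := hdh.not_excess_zero_one_two hconn jyv.symm nvx nxy hx
  clear hnot hm jxy jxv jyv nxy nxv nyv nyx nvx nvy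
  have hij : ¬ (i ≠ j ∧ j ≠ l ∧ i ≠ l) := by
    interval_cases i <;> interval_cases j <;> interval_cases l <;> omega
  clear e₁ e₂ e₃ e₄ e₅ e₆
  omega

end DistHereditary

theorem dist_le_ecc {V : Type*} [Fintype V] (G : SimpleGraph V) (v w : V) :
    G.dist v w ≤ ecc G v :=
  Finset.le_sup (f := fun w => G.dist v w) (Finset.mem_univ w)

/-- Let `x,y` be mutually distant, `u` any vertex, `v ∈ F(u)`,
`α = d(u,x)`, `β = d(u,y)`. Then
`max{α,β} ≤ e(u) ≤ max{max{α,β}, min{α,β}+2} ≤ max{α,β}+2`, and if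
`e(u) = max{α,β}+2` then `α = β = e(u)−2` and `d(v,x) = d(v,y) = d(x,y)`. -/
theorem duality_one {V : Type*} [Fintype V] (G : SimpleGraph V)
    (hconn : G.Connected) (hdh : DistHereditary G) (x y u v : V)
    (hxy : G.dist x y = ecc G x) (hyx : G.dist y x = ecc G y)
    (hv : G.dist u v = ecc G u) :
    max (G.dist u x) (G.dist u y) ≤ ecc G u ∧
    ecc G u ≤ max (max (G.dist u x) (G.dist u y)) (min (G.dist u x) (G.dist u y) + 2) ∧
    max (max (G.dist u x) (G.dist u y)) (min (G.dist u x) (G.dist u y) + 2) ≤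
      max (G.dist u x) (G.dist u y) + 2 ∧
    (ecc G u = max (G.dist u x) (G.dist u y) + 2 →
      G.dist u x + 2 = ecc G u ∧ G.dist u y + 2 = ecc G u ∧
      G.dist v x = G.dist x y ∧ G.dist v y = G.dist x y) := by
  have hx := dist_le_ecc G u x
  have hy := dist_le_ecc G u y
  have hxv := dist_le_ecc G x v
  have hyv := dist_le_ecc G y v
  have h := hdh.four_point hconn u x y v
  rw [G.dist_comm (u := v) (v := x), G.dist_comm (u := v) (v := y)]
  rw [G.dist_comm (u := y) (v := x)] at hyx
  omega
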